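/- Let (U, τ) be a Curtis table for a based complex. For every i, a basis index j of X_i lies in U_i if and only if j is the leading index of some nonzero cycle in ker d_i but j is not the leading index of any nonzero boundary (nonzero element of im d_{i−1}); that is, U_i = LT(ker d_i) \ LT(im d_{i−1}). -/

import Mathlib

/-- The leading index (an element of `WithBot (Fin m)`, which is `⊥` exactly for the zero
vector) of a vector of the based `𝔽₂`-vector space `Fin m → ZMod 2`, whose ordered basis is
the standard one. -/
def lead {m : ℕ} (v : Fin m → ZMod 2) : WithBot (Fin m) :=
  (Finset.univ.filter fun j => v j ≠ 0).max

/-- `LTset S` is the set of leading indices of the nonzero elements of the subspace `S`. -/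
def LTset {m : ℕ} (S : Submodule (ZMod 2) (Fin m → ZMod 2)) : Set (Fin m) :=
  {j | ∃ v ∈ S, v ≠ 0 ∧ lead v = (j : WithBot (Fin m))}

/-- A based complex `X_0 → X_1 → ⋯ → X_N` of finite-dimensional `𝔽₂`-vector spaces with
ordered bases: `X_i` is modelled as `Fin (n i) → ZMod 2` via its ordered basis, and the
complex is extended by zero spaces in degrees `> N` (so `d_N = 0` holds automatically). -/
structure BasedComplex where
  N : ℕ
  n : ℕ → ℕ
  n_eq_zero : ∀ i, N < i → n i = 0
  d : ∀ i : ℕ, (Fin (n i) → ZMod 2) →ₗ[ZMod 2] (Fin (n (i + 1)) → ZMod 2)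
  d_comp : ∀ i, (d (i + 1)).comp (d i) = 0

namespace BasedComplex

/-- The cycles `ker d_i`. -/
def cyc (C : BasedComplex) (i : ℕ) : Submodule (ZMod 2) (Fin (C.n i) → ZMod 2) :=
  LinearMap.ker (C.d i)

/-- The boundaries `im d_{i-1}`, with the convention `d_{-1} = 0`. -/
def bdry (C : BasedComplex) : ∀ i : ℕ, Submodule (ZMod 2) (Fin (C.n i) → ZMod 2)
  | 0 => ⊥
  | (i + 1) => LinearMap.range (C.d i)

theorem bdry_zero (C : BasedComplex) : C.bdry 0 = ⊥ := rfl

theorem bdry_succ (C : BasedComplex) (i : ℕ) :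
    C.bdry (i + 1) = LinearMap.range (C.d i) := rfl

/-- The boundaries, viewed as a submodule of the cycles. -/
def bdryIn (C : BasedComplex) (i : ℕ) : Submodule (ZMod 2) (C.cyc i) :=
  (C.bdry i).comap (C.cyc i).subtype

/-- The homology `H_i = ker d_i / im d_{i-1}`. -/
abbrev homology (C : BasedComplex) (i : ℕ) :=
  C.cyc i ⧸ C.bdryIn i

end BasedComplex

/-- Given tag data `t`, where `t i k = some j` means that the basis index `k` of `X_i` is
tagged with target the basis index `j` of `X_{i+1}` (i.e. `τ_{i+1}(k) = j`),
`tagImage C t i` is the image of the partial function `τ_i` (which is empty for `i = 0`). -/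
def tagImage (C : BasedComplex) (t : ∀ i, Fin (C.n i) → Option (Fin (C.n (i + 1)))) :
    ∀ i : ℕ, Set (Fin (C.n i))
  | 0 => ∅
  | (i + 1) => {j | ∃ k, t i k = some j}

/-- A Curtis table for a based complex.  Here `t i` encodes the injective partial function
`τ_{i+1}` from the basis indices of `X_i` to the basis indices of `X_{i+1}`
(`t i k = some j` means `τ_{i+1}(k) = j`; the partial function `τ_0` is empty by
convention, and `τ_{N+1}` is automatically empty since `X_{N+1} = 0`). -/
structure CurtisTable (C : BasedComplex) where
  /-- the untagged items in each degree -/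
  U : ∀ i, Set (Fin (C.n i))
  /-- the tags -/
  t : ∀ i, Fin (C.n i) → Option (Fin (C.n (i + 1)))
  /-- the tags form an injective partial function -/
  t_inj : ∀ i k k' j, t i k = some j → t i k' = some j → k = k'
  /-- (i): `U_i` and the image of `τ_i` are disjoint … -/
  disj : ∀ i, Disjoint (U i) (tagImage C t i)
  /-- (i): … and their union is `LT(ker d_i)` -/
  union_eq : ∀ i, U i ∪ tagImage C t i = LTset (C.cyc i)
  /-- (ii): no index is both untagged and in the domain of `τ_{i+1}` -/
  mem_U_not_dom : ∀ i j, j ∈ U i → t i j = none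
  /-- (ii): no index is both in the image of `τ_i` and in the domain of `τ_{i+1}` -/
  mem_tagImage_not_dom : ∀ i j, j ∈ tagImage C t i → t i j = none
  /-- (ii): every basis index is untagged, or in the image of `τ_i`, or in the domain of
  `τ_{i+1}` -/
  cover : ∀ i j, j ∈ U i ∨ j ∈ tagImage C t i ∨ (t i j).isSome
  /-- (iii): if `τ_{i+1}(k) = j` then there is an `x` with leading index `k` such that
  `d_i x ≠ 0` and `d_i x` has leading index `j` -/
  tag_spec : ∀ i k j, t i k = some j →
    ∃ x : Fin (C.n i) → ZMod 2, lead x = (k : WithBot (Fin (C.n i))) ∧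
      C.d i x ≠ 0 ∧ lead (C.d i x) = (j : WithBot (Fin (C.n (i + 1))))

theorem lead_eq_coe_iff {m : ℕ} (v : Fin m → ZMod 2) (j : Fin m) :
    lead v = (j : WithBot (Fin m)) ↔ v j ≠ 0 ∧ ∀ i, j < i → v i = 0 := by
  constructor
  · intro h
    refine ⟨(Finset.mem_filter.1 (Finset.mem_of_max h)).2, fun i hi => ?_⟩
    by_contra hv
    exact absurd (Finset.le_max_of_eq
      (Finset.mem_filter.2 ⟨Finset.mem_univ i, hv⟩) h) (not_le.2 hi)
  · rintro ⟨hj, h⟩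
    refine le_antisymm (Finset.max_le fun i hi => ?_)
      (Finset.le_max (Finset.mem_filter.2 ⟨Finset.mem_univ j, hj⟩))
    have hv := (Finset.mem_filter.1 hi).2
    exact WithBot.coe_le_coe.2 (not_lt.1 fun hlt => hv (h i hlt))

theorem lead_add_of_ne {m : ℕ} {v w : Fin m → ZMod 2} {i j : Fin m}
    (hv : lead v = (i : WithBot (Fin m))) (hw : lead w = (j : WithBot (Fin m))) (hij : i ≠ j) :
    lead (v + w) = (i : WithBot (Fin m)) ∨ lead (v + w) = (j : WithBot (Fin m)) := by
  simp only [lead_eq_coe_iff, Pi.add_apply] at *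
  rcases lt_or_gt_of_ne hij with h | h
  · exact Or.inr ⟨by simpa [hv.2 j h] using hw.1,
      fun k hk => by simp [hv.2 k (h.trans hk), hw.2 k hk]⟩
  · exact Or.inl ⟨by simpa [hw.2 i h] using hv.1,
      fun k hk => by simp [hw.2 k (h.trans hk), hv.2 k hk]⟩

theorem LTset_bot {m : ℕ} : LTset (⊥ : Submodule (ZMod 2) (Fin m → ZMod 2)) = ∅ := by
  ext j
  simp +contextual [LTset]

/-- If every basis index is either the leading index of a kernel element or tagged by `t`, then
the leading index of `f x` is a tag of an index not exceeding the leading index of `x`. -/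
theorem exists_tag_of_map_ne_zero {m n : ℕ} (f : (Fin m → ZMod 2) →ₗ[ZMod 2] (Fin n → ZMod 2))
    (t : Fin m → Option (Fin n)) (t_inj : ∀ k k' j, t k = some j → t k' = some j → k = k')
    (tag_spec : ∀ k j, t k = some j → ∃ x : Fin m → ZMod 2,
      lead x = (k : WithBot (Fin m)) ∧ lead (f x) = (j : WithBot (Fin n)))
    (cover : ∀ k, k ∈ LTset (LinearMap.ker f) ∨ (t k).isSome) (b : ℕ) (x : Fin m → ZMod 2)
    (hx : ∀ i : Fin m, b ≤ i → x i = 0) (hfx : f x ≠ 0) :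
    ∃ k j, k.val < b ∧ t k = some j ∧ lead (f x) = (j : WithBot (Fin n)) := by
  induction b generalizing x with
  | zero =>
    have : x = 0 := funext fun i => hx i (Nat.zero_le _)
    simp [this] at hfx
  | succ b ih =>
    have weaken : (∃ k j, k.val < b ∧ t k = some j ∧ lead (f x) = (j : WithBot (Fin n))) →
        ∃ k j, k.val < b + 1 ∧ t k = some j ∧ lead (f x) = (j : WithBot (Fin n)) :=
      fun ⟨k, j, hk, h⟩ => ⟨k, j, hk.trans (Nat.lt_succ_self b), h⟩
    by_cases hb : ∃ k : Fin m, k.val = b ∧ x k ≠ 0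
    · obtain ⟨k, rfl, hk⟩ := hb
      have reduce : ∀ y : Fin m → ZMod 2, lead y = (k : WithBot (Fin m)) →
          ∀ i : Fin m, k.val ≤ i → (x - y) i = 0 := by
        intro y hy i hi
        rw [lead_eq_coe_iff] at hy
        rcases eq_or_lt_of_le hi with h | h
        · obtain rfl : k = i := Fin.ext h
          have key : ∀ a c : ZMod 2, a ≠ 0 → c ≠ 0 → a - c = 0 := by decide
          exact key _ _ hk hy.1
        · simp [hx i h, hy.2 i h]
      rcases cover k with ⟨y, hy, -, hly⟩ | hs
      · have hf : f (x - y) = f x := by simp [LinearMap.mem_ker.1 hy]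
        rw [← hf] at weaken hfx ⊢
        exact weaken (ih _ (reduce y hly) hfx)
      · obtain ⟨j, hj⟩ := Option.isSome_iff_exists.1 hs
        obtain ⟨y, hly, hlfy⟩ := tag_spec k j hj
        have hf : f x = f (x - y) + f y := by simp
        by_cases h0 : f (x - y) = 0
        · exact ⟨k, j, Nat.lt_succ_self _, hj, by rw [hf, h0, zero_add, hlfy]⟩
        · obtain ⟨k', j', hk', hj', hl⟩ := ih _ (reduce y hly) h0
          have hne : j' ≠ j := by
            rintro rfl
            exact hk'.ne (congrArg Fin.val (t_inj _ _ _ hj' hj))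
          rw [hf]
          rcases lead_add_of_ne hl hlfy hne with h | h
          · exact ⟨k', j', hk'.trans (Nat.lt_succ_self _), hj', h⟩
          · exact ⟨k, j, Nat.lt_succ_self _, hj, h⟩
    · push Not at hb
      refine weaken (ih x (fun i hi => ?_) hfx)
      rcases eq_or_lt_of_le hi with h | h
      · exact hb i h.symm
      · exact hx i h

theorem CurtisTable.tagImage_eq_LTset_bdry {C : BasedComplex} (T : CurtisTable C) (i : ℕ) :
    tagImage C T.t i = LTset (C.bdry i) := by
  cases i with
  | zero => exact LTset_bot.symm
  | succ i =>
    ext j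
    constructor
    · rintro ⟨k, hk⟩
      obtain ⟨x, -, h0, hl⟩ := T.tag_spec i k j hk
      exact ⟨C.d i x, ⟨x, rfl⟩, h0, hl⟩
    · rintro ⟨_, ⟨x, rfl⟩, h0, hl⟩
      obtain ⟨k, j', -, hk, hl'⟩ := exists_tag_of_map_ne_zero (C.d i) (T.t i) (T.t_inj i)
        (fun k j h => (T.tag_spec i k j h).imp fun _ hx => ⟨hx.1, hx.2.2⟩)
        (fun k => by
          have hU : T.U i ∪ tagImage C T.t i = LTset (LinearMap.ker (C.d i)) := T.union_eq i
          rw [← hU, Set.mem_union, or_assoc]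
          exact T.cover i k)
        (C.n i) x (fun a ha => absurd a.isLt (not_lt.2 ha)) h0
      obtain rfl : j = j' := WithBot.coe_injective (hl.symm.trans hl')
      exact ⟨k, hk⟩


/-- The untagged items in degree `i` are exactly the leading indices of nonzero cycles
that are not leading indices of nonzero boundaries: `U_i = LT(ker d_i) \\ LT(im d_{i-1})`. -/
theorem U_eq_LT_cyc_diff_LT_bdry (C : BasedComplex) (T : CurtisTable C) (i : ℕ) :
    T.U i = LTset (C.cyc i) \ LTset (C.bdry i) := by
  rw [← T.union_eq i, ← T.tagImage_eq_LTset_bdry i, Set.union_sdiff_right,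
    (T.disj i).sdiff_eq_left]
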